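/- Assume the polyhedral inverse-sequence setup (hypotheses (i)–(vi), P_i = |τ_i| nonempty compact subpolyhedra of I^{n_i} with triangulations τ̃_i subdivided by τ_i of mesh < δ_i, collapsible on each simplex of τ̃_i, and simplicial bonding maps g_i^{i+1}), and assume further that for each x ∈ X and i ∈ ℕ there is a contractible polyhedron P_{x,i}, which is the closed star of a vertex in the triangulation τ̃_i, such that B_{x,i} ⊂ P_{x,i} ⊂ B^#_{x,i}. Then the limit map π : Z → X is a cell-like map. -/

import Mathlib

open Set Topology Filter

/-! ### General topological notions -/

/-- Covering dimension at most `n`: every open cover has an open refinement of order `≤ n + 1`. -/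
def CovDimLE (X : Type) [TopologicalSpace X] (n : ℕ) : Prop :=
  ∀ 𝒰 : Set (Set X), (∀ U ∈ 𝒰, IsOpen U) → ⋃₀ 𝒰 = Set.univ →
    ∃ 𝒱 : Set (Set X), (∀ V ∈ 𝒱, IsOpen V) ∧ ⋃₀ 𝒱 = Set.univ ∧
      (∀ V ∈ 𝒱, ∃ U ∈ 𝒰, V ⊆ U) ∧
      ∀ x : X, {V ∈ 𝒱 | x ∈ V}.Finite ∧ {V ∈ 𝒱 | x ∈ V}.ncard ≤ n + 1

/-- A nonempty compactum has trivial shape (the shape of a point) iff every map of it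
into an ANR (equivalently, into an open subset of a Euclidean space) is null-homotopic. -/
def HasTrivialShape (Y : Type) [TopologicalSpace Y] : Prop :=
  Nonempty Y ∧
  ∀ (n : ℕ) (U : Set (EuclideanSpace ℝ (Fin n))), IsOpen U →
    ∀ f : C(Y, U), f.Nullhomotopic

/-- `A` is an absolute neighborhood retract: it is metrizable, and for every closed
embedding of `A` into a metrizable space `M`, the image is a retract of some
neighborhood of it in `M`. -/
def IsANR (A : Type) [TopologicalSpace A] : Prop :=
  TopologicalSpace.MetrizableSpace A ∧
  ∀ (M : Type) [TopologicalSpace M], TopologicalSpace.MetrizableSpace M →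
    ∀ e : A → M, Topology.IsClosedEmbedding e →
      ∃ (U : Set M) (ret : U → A), IsOpen U ∧ Set.range e ⊆ U ∧ Continuous ret ∧
        ∀ (a : A) (h : e a ∈ U), ret ⟨e a, h⟩ = a

/-- Property `UV^k` for a space (to be applied to fibers of maps): for every embedding
into an ANR `A`, every neighborhood `U` of the image contains a smaller neighborhood `V`
such that every map of `S^r`, `0 ≤ r ≤ k`, into `V` is null-homotopic in `U`. -/
def HasPropertyUV (k : ℕ) (Y : Type) [TopologicalSpace Y] : Prop :=
  ∀ (A : Type) [TopologicalSpace A], IsANR A →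
    ∀ e : Y → A, Topology.IsEmbedding e →
      ∀ U : Set A, IsOpen U → Set.range e ⊆ U →
        ∃ V : Set A, IsOpen V ∧ Set.range e ⊆ V ∧ ∃ hVU : V ⊆ U,
          ∀ r : ℕ, r ≤ k →
            ∀ f : C((Metric.sphere (0 : EuclideanSpace ℝ (Fin (r + 1))) 1 : Set _), V),
              ((⟨Set.inclusion hVU, continuous_inclusion hVU⟩ : C(V, U)).comp f).Nullhomotopic

/-- `T` is an Eilenberg–MacLane space of type `K(G, n)`. -/
def IsEilenbergMacLane (G : Type) [AddCommGroup G] (n : ℕ) (T : Type) [TopologicalSpace T] :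
    Prop :=
  PathConnectedSpace T ∧
  ∀ t : T,
    (∀ m : ℕ, m ≠ n → Subsingleton (HomotopyGroup (Fin m) T t)) ∧
    Nonempty (HomotopyGroup (Fin n) T t ≃ G) ∧
    ∀ hn : 0 < n,
      letI : Nonempty (Fin n) := ⟨⟨0, hn⟩⟩
      Nonempty (HomotopyGroup (Fin n) T t ≃* Multiplicative G)

/-- A compactum has trivial reduced Čech cohomology with coefficients in `G` iff
every map of it into an Eilenberg–MacLane space `K(G, n)` (realized as an ANR)
is null-homotopic. -/
def HasTrivialCechCohomology (G : Type) [AddCommGroup G] (Y : Type) [TopologicalSpace Y] :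
    Prop :=
  ∀ (n : ℕ) (T : Type) [TopologicalSpace T], IsANR T → IsEilenbergMacLane G n T →
    ∀ f : C(Y, T), f.Nullhomotopic

/-- Cohomological dimension `dim_G Y ≤ n`: every map from a closed subset of `Y` into a
`K(G, n)` extends over `Y`. -/
def CohomDimLE (G : Type) [AddCommGroup G] (Y : Type) [TopologicalSpace Y] (n : ℕ) : Prop :=
  ∀ A : Set Y, IsClosed A →
    ∀ (T : Type) [TopologicalSpace T], IsANR T → IsEilenbergMacLane G n T →
      ∀ f : C(A, T), ∃ F : C(Y, T), ∀ a : A, F a = f a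

open Set Topology Filter

noncomputable section

/-! ### The Hilbert cube `Q = ∏_{i=1}^∞ I` realized inside `ℕ → ℝ` -/

/-- The ambient space `ℝ^∞` containing the Hilbert cube. -/
abbrev ESp : Type := ℕ → ℝ

/-- The metric `ρ(x, y) = ∑_{i=1}^∞ |x_i - y_i| / 2^i` on the Hilbert cube. -/
noncomputable def rho (x y : ESp) : ℝ := ∑' i : ℕ, |x i - y i| / 2 ^ (i + 1)

/-- The coordinate projection `p_n : Q → I^n` (followed by the identification of
`I^n` with the slice `I^n × {0} ⊆ Q`). -/
def proj (n : ℕ) (x : ESp) : ESp := fun j => if j < n then x j else 0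

/-- The Hilbert cube `Q`. -/
def HCube : Set ESp := {x | ∀ i, x i ∈ Set.Icc (0 : ℝ) 1}

/-- The slice `I^n × {0} ⊆ Q`, the canonical copy of `I^n` in `Q`. -/
def cubeSlice (n : ℕ) : Set ESp := {x ∈ HCube | ∀ j, n ≤ j → x j = 0}

/-- `P × Q_n ⊆ Q = I^n × Q_n`, for a subset `P` of the slice `I^n × {0}`. -/
def tube (P : Set ESp) (n : ℕ) : Set ESp := {x ∈ HCube | proj n x ∈ P}

/-- The data and hypotheses (i)–(vi) of the inverse-sequence setup of Lemma 3.1. -/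
structure InvSeqSetup where
  n : ℕ → ℕ
  P : ℕ → Set ESp
  δ : ℕ → ℝ
  ε : ℕ → ℝ
  /-- the bonding maps `g_i^{i+1} : P_{i+1} → P_i` -/
  g : ℕ → ESp → ESp
  P_sub : ∀ i, P i ⊆ cubeSlice (n i)
  P_cpt : ∀ i, IsCompact (P i)
  δ_pos : ∀ i, 0 < δ i
  ε_pos : ∀ i, 0 < ε i
  g_maps : ∀ i, Set.MapsTo (g i) (P (i + 1)) (P i)
  g_cont : ∀ i, ContinuousOn (g i) (P (i + 1))
  /-- (i) -/
  hyp1 : ∀ i, ∀ u ∈ HCube, ∀ v ∈ HCube,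
    rho u v ≤ ε (i + 1) → rho (proj (n i) u) (proj (n i) v) < δ i
  /-- (ii) -/
  hyp2 : ∀ i, n i < n (i + 1)
  /-- (iii) -/
  hyp3 : ∀ i, 9 / 2 ^ n i < ε i
  /-- (iv) -/
  hyp4 : ∀ i, ∀ x ∈ P (i + 1), rho (g i x) (proj (n i) x) < δ i
  /-- (v) -/
  hyp5 : ∀ i, δ i < 1 / 2 ^ (n i - 1)
  /-- (vi) -/
  hyp6 : ∀ i, tube (P (i + 1)) (n (i + 1)) ⊆ tube (P i) (n i)

namespace InvSeqSetup

/-- `X = ∩_{i=1}^∞ P_i × Q_{n_i}`. -/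
def X (S : InvSeqSetup) : Set ESp := ⋂ i, tube (S.P i) (S.n i)

/-- `Z = lim (P_i, g_i^{i+1})`: the space of threads of the inverse sequence. -/
abbrev Thread (S : InvSeqSetup) : Type :=
  {a : ℕ → ESp // (∀ i, a i ∈ S.P i) ∧ ∀ i, S.g i (a (i + 1)) = a i}

/-- `π : Z → X` is the limit map, `π(z) = lim_{i→∞} a_i` for a thread `z = (a_i)`. -/
def IsLimitMap (S : InvSeqSetup) (π : S.Thread → ESp) : Prop :=
  ∀ z : S.Thread, Filter.Tendsto (fun i => rho (z.1 i) (π z)) Filter.atTop (nhds 0)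

/-- `B_{x,i} = N̄(p_{n_i}(x), 2δ_i) ∩ P_i`. -/
def B (S : InvSeqSetup) (x : ESp) (i : ℕ) : Set ESp :=
  {y ∈ cubeSlice (S.n i) | rho y (proj (S.n i) x) ≤ 2 * S.δ i} ∩ S.P i

/-- `B^#_{x,i} = N̄(p_{n_i}(x), ε_i) ∩ P_i`. -/
def Bs (S : InvSeqSetup) (x : ESp) (i : ℕ) : Set ESp :=
  {y ∈ cubeSlice (S.n i) | rho y (proj (S.n i) x) ≤ S.ε i} ∩ S.P i

end InvSeqSetup

end

open Set Topology Geometry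

/-! ### Polyhedra, triangulations, skeleta, subdivisions, stars, collapsibility -/

variable {V : Type} [AddCommGroup V] [Module ℝ V]

/-- The subpolyhedron `|τ^{(k)}|` spanned by the `k`-skeleton of a simplicial complex. -/
def skelSet (K : Geometry.SimplicialComplex ℝ V) (k : ℕ) : Set V :=
  ⋃ s ∈ {s ∈ K.faces | s.card ≤ k + 1}, convexHull ℝ (s : Set V)

/-- `K` is a subdivision of `K'`. -/
def IsSubdivisionOf (K K' : Geometry.SimplicialComplex ℝ V) : Prop :=
  K.space = K'.space ∧
  ∀ s ∈ K.faces, ∃ t ∈ K'.faces, convexHull ℝ (s : Set V) ⊆ convexHull ℝ (t : Set V)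

/-- `K'` is the restriction of the simplicial complex `K` to the set `A`:
its faces are exactly the faces of `K` lying in `A`. -/
def RestrictsTo (K : Geometry.SimplicialComplex ℝ V) (A : Set V)
    (K' : Geometry.SimplicialComplex ℝ V) : Prop :=
  K'.faces = {s ∈ K.faces | convexHull ℝ (s : Set V) ⊆ A}

/-- An elementary collapse from `K` to `K'` through a free face `σ`. -/
def ElemCollapse (K K' : Geometry.SimplicialComplex ℝ V) : Prop :=
  ∃ σ τ : Finset V, σ ∈ K.faces ∧ τ ∈ K.faces ∧ σ ⊂ τ ∧
    (∀ ρ ∈ K.faces, σ ⊆ ρ → ρ = σ ∨ ρ = τ) ∧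
    K'.faces = K.faces \ {ρ | σ ⊆ ρ}

/-- A simplicial complex is collapsible if it collapses to a single vertex. -/
def IsCollapsible (K : Geometry.SimplicialComplex ℝ V) : Prop :=
  ∃ K' : Geometry.SimplicialComplex ℝ V,
    Relation.ReflTransGen ElemCollapse K K' ∧ ∃ v : V, K'.faces = {{v}}

/-- `g` is a simplicial map from `K` to `K'`: it sends vertices of any face of `K` into
a face of `K'` and is affine on each closed simplex of `K`. -/
def IsSimplicialMapOn (K K' : Geometry.SimplicialComplex ℝ V) (g : V → V) : Prop :=
  (∀ s ∈ K.faces, ∃ t ∈ K'.faces, g '' (s : Set V) ⊆ (t : Set V)) ∧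
  ∀ s ∈ K.faces, ∀ w : V → ℝ, (∀ v ∈ s, 0 ≤ w v) → ∑ v ∈ s, w v = 1 →
    g (∑ v ∈ s, w v • v) = ∑ v ∈ s, w v • g v

/-- The closed star of a vertex `v` in a simplicial complex `K`: the union of all closed
simplexes of `K` containing `v`. -/
def closedStar (K : Geometry.SimplicialComplex ℝ V) (v : V) : Set V :=
  ⋃ s ∈ {s ∈ K.faces | v ∈ s}, convexHull ℝ (s : Set V)

/-- The boundary `∂σ` of a simplex with vertex set `s`: the union of its proper faces. -/
def simplexBoundary (s : Finset V) : Set V :=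
  letI := Classical.decEq V
  ⋃ v ∈ s, convexHull ℝ ((s.erase v : Finset V) : Set V)

/-- The bundled inclusion map between subspaces. -/
def inclusionMap {W : Type} [TopologicalSpace W] {A B : Set W} (h : A ⊆ B) : C(A, B) :=
  ⟨Set.inclusion h, continuous_inclusion h⟩

/-- `g` is a generator of the abelian group `M` (i.e. `M = ⟨g⟩`). -/
def IsZGenerator {M : Type} [AddCommGroup M] (g : M) : Prop :=
  ∀ x : M, ∃ k : ℤ, x = k • g

/-! ### The polyhedral inverse-sequence setup -/

/-- The polyhedral inverse-sequence setup of Corollary 2.2: each `P_i` is a nonempty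
compact subpolyhedron of `I^{n_i}` with a triangulation `τ̃_i` and a subdivision `τ_i`
of mesh `< δ_i` which is collapsible on every simplex of `τ̃_i`, and the bonding maps
are simplicial from `τ_{i+1}` to `τ_i`. -/
structure PolySetup extends InvSeqSetup where
  /-- the triangulations `τ_i` of `P_i` -/
  tri : ℕ → Geometry.SimplicialComplex ℝ ESp
  /-- the coarser triangulations `τ̃_i` of `P_i` -/
  triT : ℕ → Geometry.SimplicialComplex ℝ ESp
  P_ne : ∀ i, (P i).Nonempty
  tri_space : ∀ i, (tri i).space = P i
  triT_space : ∀ i, (triT i).space = P i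
  tri_subdiv : ∀ i, IsSubdivisionOf (tri i) (triT i)
  /-- `mesh τ_i < δ_i` -/
  tri_mesh : ∀ i, ∀ s ∈ (tri i).faces, ∀ x ∈ convexHull ℝ (s : Set ESp),
    ∀ y ∈ convexHull ℝ (s : Set ESp), rho x y < δ i
  /-- `τ_i` restricted to any simplex `γ` of `τ̃_i` is collapsible -/
  tri_collapsible : ∀ i, ∀ γ ∈ (triT i).faces, ∃ K : Geometry.SimplicialComplex ℝ ESp,
    RestrictsTo (tri i) (convexHull ℝ (γ : Set ESp)) K ∧ IsCollapsible K
  /-- each `g_i^{i+1}` is simplicial from `τ_{i+1}` to `τ_i` -/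
  g_simp : ∀ i, IsSimplicialMapOn (tri (i + 1)) (tri i) (g i)

namespace PolySetup

/-- The subpolyhedron `P_i^{(k)}` of `P_i`. -/
def skelP (S : PolySetup) (i k : ℕ) : Set ESp := skelSet (S.tri i) k

/-- `A = lim (P_i^{(l)}, g_i^{i+1})`, a closed subspace of `Z`. -/
def A (S : PolySetup) (l : ℕ) : Set S.toInvSeqSetup.Thread :=
  {z | ∀ i, z.1 i ∈ S.skelP i l}

/-- A system of contractible subdivided vertex stars: for each `x ∈ X` and `i`, the
polyhedron `P_{x,i}` is the closed star of a vertex of `τ̃_i` (subdivided by `τ_i`),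
it is contractible, and `B_{x,i} ⊆ P_{x,i} ⊆ B^#_{x,i}`. -/
def IsVertexStarSystem (S : PolySetup) (star : ESp → ℕ → Set ESp) : Prop :=
  ∀ x ∈ S.toInvSeqSetup.X, ∀ i : ℕ,
    (∃ v : ESp, {v} ∈ (S.triT i).faces ∧ star x i = closedStar (S.triT i) v) ∧
    ContractibleSpace ↥(star x i) ∧
    S.toInvSeqSetup.B x i ⊆ star x i ∧ star x i ⊆ S.toInvSeqSetup.Bs x i

end PolySetup
/-! ### Inverse limits of compacta with null-homotopic bonding maps -/

namespace InverseSequence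

variable {B : ℕ → Type} [∀ i, TopologicalSpace (B i)] (g : ∀ i, C(B (i + 1), B i))

/-- The points of the product satisfying the first `l` thread conditions. -/
def partialThreads (l : ℕ) : Set (∀ i, B i) := {a | ∀ i < l, g i (a (i + 1)) = a i}

/-- The inverse limit of the sequence, as a subset of the product. -/
def limit : Set (∀ i, B i) := {a | ∀ i, g i (a (i + 1)) = a i}

theorem antitone_partialThreads : Antitone (partialThreads g) :=
  fun _ _ hlm _ ha i hi => ha i (hi.trans_le hlm)

theorem iInter_partialThreads : ⋂ l, partialThreads g l = limit g := by
  ext a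
  simp only [mem_iInter]
  exact ⟨fun h i => h (i + 1) i i.lt_succ_self, fun h _ i _ => h i⟩

theorem isClosed_partialThreads [∀ i, T2Space (B i)] (l : ℕ) :
    IsClosed (partialThreads g l) := by
  simp only [partialThreads, ofPred_forall]
  exact isClosed_iInter fun i => isClosed_iInter fun _ =>
    isClosed_eq (by fun_prop) (by fun_prop)

theorem isClosed_limit [∀ i, T2Space (B i)] : IsClosed (limit g) := by
  rw [← iInter_partialThreads]
  exact isClosed_iInter (isClosed_partialThreads g)

/-- Extend a point `b` of the `l`-th stage to a point of the product, using the bonding maps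
below `l` and the constants `c` above `l`. -/
def extend (c : ∀ i, B i) : (l : ℕ) → B l → ∀ i, B i
  | 0, b => Function.update c 0 b
  | l + 1, b => Function.update (extend c l (g l b)) (l + 1) b

theorem continuous_extend (c : ∀ i, B i) (l : ℕ) : Continuous (extend g c l) := by
  induction l with
  | zero => exact continuous_const.update 0 continuous_id
  | succ l ih => exact (ih.comp (g l).continuous).update (l + 1) continuous_id

theorem extend_self (c : ∀ i, B i) (l : ℕ) (b : B l) : extend g c l b l = b := by
  cases l <;> simp [extend]

theorem extend_mem_partialThreads (c : ∀ i, B i) (l : ℕ) (b : B l) :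
    extend g c l b ∈ partialThreads g l := by
  induction l with
  | zero => intro i hi; omega
  | succ l ih =>
    intro i hi
    rcases Nat.lt_succ_iff_lt_or_eq.mp hi with h | rfl
    · simpa [extend, Function.update_of_ne (show i + 1 ≠ l + 1 by omega),
        Function.update_of_ne (show i ≠ l + 1 by omega)] using ih (g l b) i h
    · simp [extend, extend_self]

theorem extend_apply_of_mem_limit (c : ∀ i, B i) {a : ∀ i, B i} (ha : a ∈ limit g) (l : ℕ) :
    ∀ i ≤ l, extend g c l (a l) i = a i := by
  induction l with
  | zero =>
    intro i hi
    obtain rfl : i = 0 := by omega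
    simp [extend]
  | succ l ih =>
    intro i hi
    rcases hi.lt_or_eq with h | rfl
    · rw [extend, Function.update_of_ne h.ne, ha l]
      exact ih i (by omega)
    · simp [extend]

variable [∀ i, CompactSpace (B i)] [∀ i, T2Space (B i)]

theorem nonempty_limit [∀ i, Nonempty (B i)] : (limit g).Nonempty := by
  rw [← iInter_partialThreads]
  have hc := isClosed_partialThreads g
  refine IsCompact.nonempty_iInter_of_sequence_nonempty_isCompact_isClosed _
    (fun l => antitone_partialThreads g l.le_succ) (fun l => ?_) (hc 0).isCompact hc
  exact ⟨_, extend_mem_partialThreads g (fun _ => Classical.arbitrary _) l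
    (Classical.arbitrary _)⟩

/-- Every map of the inverse limit to an open subset of a normed space with the Tietze
extension property factors up to homotopy through all sufficiently late stages. -/
theorem exists_homotopic_comp_eval [∀ i, Nonempty (B i)] {E : Type} [NormedAddCommGroup E]
    [NormedSpace ℝ E] [TietzeExtension.{0, 0} E] {U : Set E} (hU : IsOpen U)
    (f : C(limit g, U)) :
    ∃ (l : ℕ) (h : C(B l, U)),
      f.Homotopic (h.comp ⟨fun a => a.1 l, (continuous_apply l).comp continuous_subtype_val⟩) := by
  have hcl := isClosed_limit g
  obtain ⟨F, hF⟩ := ContinuousMap.exists_restrict_eq hcl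
    ((⟨Subtype.val, continuous_subtype_val⟩ : C(U, E)).comp f)
  replace hF : ∀ a : limit g, F a = f a := fun a => congrArg (fun φ => φ a) hF
  obtain ⟨ε, hε, hεU⟩ := (hcl.isCompact.image F.continuous).exists_thickening_subset_open hU
    (by rintro _ ⟨a, ha, rfl⟩; rw [hF ⟨a, ha⟩]; exact (f _).2)
  have hball : ∀ a ∈ limit g, Metric.ball (F a) ε ⊆ U := fun a ha =>
    (Metric.ball_subset_thickening (mem_image_of_mem F ha) ε).trans hεU
  obtain ⟨l₀, hl₀⟩ : ∃ l, partialThreads g l ⊆ F ⁻¹' U := by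
    refine exists_subset_nhds_of_compactSpace (antitone_partialThreads g).directed_ge
      (isClosed_partialThreads g) fun a ha => (hU.preimage F.continuous).mem_nhds ?_
    rw [iInter_partialThreads] at ha
    exact hball a ha (Metric.mem_ball_self hε)
  let C : ℕ → Set ((∀ i, B i) × (∀ i, B i)) := fun l => {p | ∀ i ≤ l, p.1 i = p.2 i}
  obtain ⟨l₁, hl₁⟩ : ∃ l, C l ⊆ {p | dist (F p.1) (F p.2) < ε} := by
    refine exists_subset_nhds_of_compactSpace (V := C)
      (Antitone.directed_ge fun l m hlm p hp i hi => hp i (hi.trans hlm)) (fun l => ?_) ?_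
    · simp only [C, ofPred_forall]
      exact isClosed_iInter fun i => isClosed_iInter fun _ =>
        isClosed_eq (by fun_prop) (by fun_prop)
    · rintro ⟨a, b⟩ hab
      obtain rfl : a = b := funext fun i => mem_iInter.mp hab i i le_rfl
      exact (isOpen_lt (by fun_prop) continuous_const).mem_nhds (by simpa using hε)
  let c : ∀ i, B i := fun _ => Classical.arbitrary _
  let l := max l₀ l₁
  let h : C(B l, U) := ⟨fun b => ⟨F (extend g c l b), hl₀
    (antitone_partialThreads g (le_max_left _ _) (extend_mem_partialThreads g c l b))⟩,
    (F.continuous.comp (continuous_extend g c l)).subtype_mk _⟩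
  refine ⟨l, h, ⟨⟨⟨fun p => ⟨AffineMap.lineMap (F p.2.1) (F (extend g c l (p.2.1 l))) (p.1 : ℝ),
    ?_⟩, ?_⟩, ?_, ?_⟩⟩⟩
  · refine hball _ p.2.2 ((convex_ball _ _).lineMap_mem (Metric.mem_ball_self hε) ?_ p.1.2)
    exact hl₁ (a := (_, _)) fun i hi =>
      extend_apply_of_mem_limit g c p.2.2 l i (hi.trans (le_max_right _ _))
  · have hval : Continuous fun p : unitInterval × limit g => p.2.1 :=
      continuous_subtype_val.comp continuous_snd
    simp only [AffineMap.lineMap_apply_module]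
    refine Continuous.subtype_mk (Continuous.add (Continuous.smul (by fun_prop)
      (F.continuous.comp hval)) (Continuous.smul (by fun_prop) (F.continuous.comp ?_))) _
    exact (continuous_extend g c l).comp ((continuous_apply l).comp hval)
  · intro a
    simp [hF]
  · intro a
    simp [h]

/-- The inverse limit of a sequence of nonempty compact Hausdorff spaces with null-homotopic
bonding maps has trivial shape. -/
theorem hasTrivialShape_limit [∀ i, Nonempty (B i)] (hg : ∀ i, (g i).Nullhomotopic) :
    HasTrivialShape (limit g) := by
  refine ⟨(nonempty_limit g).to_subtype, fun n U hU f => ?_⟩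
  obtain ⟨l, h, hfh⟩ := exists_homotopic_comp_eval g hU f
  have hnull := ((hg l).comp_right h).comp_left
    (⟨fun a => a.1 (l + 1), (continuous_apply _).comp continuous_subtype_val⟩ : C(limit g, _))
  obtain ⟨y, hy⟩ := hnull
  refine ⟨y, hfh.trans ?_⟩
  convert hy using 1
  ext1 a
  exact congrArg h (a.2 l).symm

end InverseSequence

theorem HasTrivialShape.of_leftInverse {Y Z : Type} [TopologicalSpace Y] [TopologicalSpace Z]
    (hY : HasTrivialShape Y) (e : C(Z, Y)) (r : C(Y, Z)) (hre : Function.LeftInverse r e) :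
    HasTrivialShape Z := by
  refine ⟨hY.1.map r, fun n U hU f => ?_⟩
  convert (hY.2 n U hU (f.comp r)).comp_left e using 1
  ext1 z
  exact congrArg f (hre z).symm

/-! ### The metric of the Hilbert cube -/

theorem summable_half_pow_succ : Summable fun i : ℕ => (1 : ℝ) / 2 ^ (i + 1) := by
  simpa [pow_succ, mul_comm] using summable_geometric_two.mul_right (1 / 2 : ℝ)

theorem tsum_half_pow_succ_add (n : ℕ) : ∑' i : ℕ, (1 : ℝ) / 2 ^ (i + n + 1) = 1 / 2 ^ n := by
  have h : ∀ i : ℕ, (1 : ℝ) / 2 ^ (i + n + 1) = (1 / 2) ^ i * (1 / 2 ^ (n + 1)) := fun i => by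
    rw [add_assoc, pow_add, one_div_pow]; field_simp
  simp_rw [h]
  rw [tsum_mul_right, tsum_geometric_two, pow_succ]
  field_simp

theorem abs_sub_le_one_of_mem_HCube {x y : ESp} (hx : x ∈ HCube) (hy : y ∈ HCube) (i : ℕ) :
    |x i - y i| ≤ 1 := by
  have h₁ := hx i
  have h₂ := hy i
  exact abs_sub_le_iff.mpr ⟨by linarith [h₁.2, h₂.1], by linarith [h₁.1, h₂.2]⟩

theorem rho_term_le {x y : ESp} (hx : x ∈ HCube) (hy : y ∈ HCube) (i : ℕ) :
    |x i - y i| / 2 ^ (i + 1) ≤ 1 / 2 ^ (i + 1) := by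
  gcongr
  exact abs_sub_le_one_of_mem_HCube hx hy i

theorem summable_rho {x y : ESp} (hx : x ∈ HCube) (hy : y ∈ HCube) :
    Summable fun i : ℕ => |x i - y i| / 2 ^ (i + 1) :=
  summable_half_pow_succ.of_nonneg_of_le (fun _ => by positivity) (rho_term_le hx hy)

theorem rho_self (x : ESp) : rho x x = 0 := by simp [rho]

theorem rho_comm (x y : ESp) : rho x y = rho y x := by simp [rho, abs_sub_comm]

theorem rho_nonneg (x y : ESp) : 0 ≤ rho x y := tsum_nonneg fun _ => by positivity

theorem rho_triangle {x y z : ESp} (hx : x ∈ HCube) (hy : y ∈ HCube) (hz : z ∈ HCube) :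
    rho x z ≤ rho x y + rho y z := by
  unfold rho
  rw [← (summable_rho hx hy).tsum_add (summable_rho hy hz)]
  refine (summable_rho hx hz).tsum_le_tsum (fun i => ?_)
    ((summable_rho hx hy).add (summable_rho hy hz))
  rw [← add_div]
  gcongr
  exact abs_sub_le _ _ _

theorem eq_of_rho_eq_zero {x y : ESp} (hx : x ∈ HCube) (hy : y ∈ HCube) (h : rho x y = 0) :
    x = y := by
  funext i
  have h₁ := (summable_rho hx hy).le_tsum i fun _ _ => by positivity
  change _ ≤ rho x y at h₁
  rw [h] at h₁
  have h₂ : |x i - y i| ≤ 0 := by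
    by_contra! h₃
    have : 0 < |x i - y i| / 2 ^ (i + 1) := by positivity
    linarith
  exact sub_eq_zero.mp (abs_nonpos_iff.mp h₂)

theorem proj_mem_HCube {x : ESp} (hx : x ∈ HCube) (n : ℕ) : proj n x ∈ HCube := fun i => by
  unfold proj
  split_ifs
  · exact hx i
  · simp

theorem proj_mem_cubeSlice {x : ESp} (hx : x ∈ HCube) (n : ℕ) : proj n x ∈ cubeSlice n :=
  ⟨proj_mem_HCube hx n, fun j hj => by simp [proj, not_lt.mpr hj]⟩

theorem proj_proj {m n : ℕ} (h : m ≤ n) (x : ESp) : proj m (proj n x) = proj m x := by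
  funext i
  by_cases hi : i < m
  · simp [proj, hi, hi.trans_le h]
  · simp [proj, hi]

theorem rho_proj_le {x : ESp} (hx : x ∈ HCube) (n : ℕ) : rho (proj n x) x ≤ 1 / 2 ^ n := by
  have hQ := proj_mem_HCube hx n
  have hs := summable_rho hQ hx
  have hhead : ∑ i ∈ Finset.range n, |proj n x i - x i| / 2 ^ (i + 1) = 0 :=
    Finset.sum_eq_zero fun i hi => by simp [proj, Finset.mem_range.mp hi]
  have htail : ∑' i : ℕ, |proj n x (i + n) - x (i + n)| / 2 ^ (i + n + 1) ≤
      ∑' i : ℕ, (1 : ℝ) / 2 ^ (i + n + 1) :=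
    Summable.tsum_le_tsum (fun i => rho_term_le hQ hx (i + n))
      (hs.comp_injective (add_left_injective n))
      (summable_half_pow_succ.comp_injective (add_left_injective n))
  rw [tsum_half_pow_succ_add] at htail
  rw [rho, ← hs.sum_add_tsum_nat_add n, hhead, zero_add]
  exact htail

theorem continuousOn_rho_left {y : ESp} (hy : y ∈ HCube) :
    ContinuousOn (fun x => rho x y) HCube := by
  refine continuousOn_tsum (fun i => by fun_prop) summable_half_pow_succ fun i x hx => ?_
  rw [Real.norm_of_nonneg (by positivity)]
  exact rho_term_le hx hy i

namespace InvSeqSetup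

variable (S : InvSeqSetup)

theorem mem_HCube_of_mem_P {i : ℕ} {y : ESp} (hy : y ∈ S.P i) : y ∈ HCube := (S.P_sub i hy).1

theorem le_n (i : ℕ) : i ≤ S.n i := (strictMono_nat_of_lt_succ S.hyp2).id_le i

theorem mem_HCube_of_mem_X {x : ESp} (hx : x ∈ S.X) : x ∈ HCube := (mem_iInter.mp hx 0).1

theorem proj_mem_P {x : ESp} (hx : x ∈ S.X) (i : ℕ) : proj (S.n i) x ∈ S.P i :=
  (mem_iInter.mp hx i).2

theorem proj_mem_B {x : ESp} (hx : x ∈ S.X) (i : ℕ) : proj (S.n i) x ∈ S.B x i :=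
  ⟨⟨proj_mem_cubeSlice (S.mem_HCube_of_mem_X hx) _, by
    rw [rho_self]; linarith [S.δ_pos i]⟩, S.proj_mem_P hx i⟩

theorem isCompact_B {x : ESp} (hx : x ∈ HCube) (i : ℕ) : IsCompact (S.B x i) := by
  have hcl : IsClosed (S.P i ∩ (fun y => rho y (proj (S.n i) x)) ⁻¹' Iic (2 * S.δ i)) :=
    ((continuousOn_rho_left (proj_mem_HCube hx _)).mono
      fun _ => S.mem_HCube_of_mem_P).preimage_isClosed_of_isClosed (S.P_cpt i).isClosed isClosed_Iic
  convert (S.P_cpt i).of_isClosed_subset hcl inter_subset_left using 1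
  ext y
  exact ⟨fun h => ⟨h.2, h.1.2⟩, fun h => ⟨⟨S.P_sub i h.1, h.2⟩, h.1⟩⟩

/-- If `y ∈ P_{i+1}` is `ε_{i+1}`-close to `w`, then its image in `P_i` lies in `B_{w,i}`. -/
theorem g_mem_B_of_rho_le {w y : ESp} (hw : w ∈ HCube) {i : ℕ} (hy : y ∈ S.P (i + 1))
    (h : rho y w ≤ S.ε (i + 1)) : S.g i y ∈ S.B w i := by
  have hgP := S.g_maps i hy
  have hyQ := S.mem_HCube_of_mem_P hy
  refine ⟨⟨S.P_sub i hgP, ?_⟩, hgP⟩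
  linarith [S.hyp1 i y hyQ w hw h, S.hyp4 i y hy,
    rho_triangle (S.mem_HCube_of_mem_P hgP) (proj_mem_HCube hyQ (S.n i))
      (proj_mem_HCube hw (S.n i))]

theorem g_mem_B_of_mem_Bs {x y : ESp} (hx : x ∈ HCube) {i : ℕ} (hy : y ∈ S.Bs x (i + 1)) :
    S.g i y ∈ S.B x i := by
  have h := S.g_mem_B_of_rho_le (proj_mem_HCube hx (S.n (i + 1))) hy.2 hy.1.2
  simpa only [B, proj_proj (S.hyp2 i).le] using h

theorem delta_le (i : ℕ) : S.δ i ≤ 2 / 2 ^ S.n i := by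
  refine (S.hyp5 i).le.trans ?_
  rcases Nat.eq_zero_or_eq_succ_pred (S.n i) with h | h
  · simp [h]
  · rw [h, pow_succ]
    simp only [Nat.succ_eq_add_one, Nat.add_sub_cancel]
    apply le_of_eq
    field_simp

theorem rho_thread_succ_le (z : S.Thread) (i : ℕ) :
    rho (z.1 i) (z.1 (i + 1)) ≤ 3 / 2 ^ S.n i := by
  have hQ := fun j => S.mem_HCube_of_mem_P (z.2.1 j)
  have h₁ := S.hyp4 i _ (z.2.1 (i + 1))
  rw [z.2.2 i] at h₁
  have h₂ := rho_proj_le (hQ (i + 1)) (S.n i)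
  have h₃ := rho_triangle (hQ i) (proj_mem_HCube (hQ (i + 1)) (S.n i)) (hQ (i + 1))
  have h₄ : (3 : ℝ) / 2 ^ S.n i = 2 / 2 ^ S.n i + 1 / 2 ^ S.n i := by ring
  linarith [S.delta_le i]

theorem rho_thread_add_le (z : S.Thread) (i k : ℕ) :
    rho (z.1 i) (z.1 (i + k)) ≤ 6 / 2 ^ S.n i := by
  induction k generalizing i with
  | zero => simp only [add_zero, rho_self]; positivity
  | succ k ih =>
    have hQ := fun j => S.mem_HCube_of_mem_P (z.2.1 j)
    have h₁ := ih (i + 1)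
    rw [show i + 1 + k = i + (k + 1) by ring] at h₁
    have h₂ : (6 : ℝ) / 2 ^ S.n (i + 1) ≤ 6 / 2 ^ (S.n i + 1) := by
      gcongr
      · norm_num
      · exact S.hyp2 i
    have h₃ : (6 : ℝ) / 2 ^ (S.n i + 1) + 3 / 2 ^ S.n i = 6 / 2 ^ S.n i := by
      rw [pow_succ]; field_simp; norm_num
    linarith [S.rho_thread_succ_le z i, rho_triangle (hQ i) (hQ (i + 1)) (hQ (i + (k + 1)))]

theorem thread_mem_B {z : S.Thread} {x : ESp} (hx : x ∈ HCube)
    (hz : Tendsto (fun i => rho (z.1 i) x) atTop (𝓝 0)) (i : ℕ) : z.1 i ∈ S.B x i := by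
  have hQ := fun j => S.mem_HCube_of_mem_P (z.2.1 j)
  have hle : rho (z.1 (i + 1)) x ≤ 6 / 2 ^ S.n (i + 1) := by
    refine ge_of_tendsto' (f := fun k => 6 / 2 ^ S.n (i + 1) + rho (z.1 (i + 1 + k)) x) ?_
      (fun k => ?_) (x := atTop)
    · have := hz.comp (tendsto_add_atTop_nat (i + 1))
      simpa [Function.comp_def, add_comm] using
        this.const_add ((6 : ℝ) / 2 ^ S.n (i + 1))
    · linarith [S.rho_thread_add_le z (i + 1) k, rho_triangle (hQ (i + 1)) (hQ (i + 1 + k)) hx]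
  have h69 : (6 : ℝ) / 2 ^ S.n (i + 1) ≤ 9 / 2 ^ S.n (i + 1) := by gcongr; norm_num
  rw [← z.2.2 i]
  exact S.g_mem_B_of_rho_le hx (z.2.1 _) (by linarith [S.hyp3 (i + 1)])

theorem tendsto_rho_of_mem_B {a : ℕ → ESp} {x : ESp} (hx : x ∈ HCube)
    (ha : ∀ i, a i ∈ S.B x i) : Tendsto (fun i => rho (a i) x) atTop (𝓝 0) := by
  have hlim : Tendsto (fun i : ℕ => 5 * (1 / 2 : ℝ) ^ i) atTop (𝓝 0) := by
    simpa using (tendsto_pow_atTop_nhds_zero_of_lt_one (by norm_num : (0 : ℝ) ≤ 1 / 2)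
      (by norm_num)).const_mul 5
  refine squeeze_zero (fun i => rho_nonneg _ _) (fun i => ?_) hlim
  have h₁ := rho_triangle (S.mem_HCube_of_mem_P (ha i).2) (proj_mem_HCube hx (S.n i)) hx
  have h₂ := (ha i).1.2
  have h₃ : 2 * (2 / 2 ^ S.n i) + 1 / 2 ^ S.n i = 5 * (1 / 2 : ℝ) ^ S.n i := by
    rw [one_div_pow]; ring
  have h₄ : (1 / 2 : ℝ) ^ S.n i ≤ (1 / 2) ^ i :=
    pow_le_pow_of_le_one (by norm_num) (by norm_num) (S.le_n i)
  linarith [S.delta_le i, rho_proj_le hx (S.n i)]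

theorem IsLimitMap.apply_eq_iff {S : InvSeqSetup} {π : S.Thread → ESp} (hπ : S.IsLimitMap π)
    (hπX : ∀ z, π z ∈ S.X) {x : ESp} (hx : x ∈ HCube) (z : S.Thread) :
    π z = x ↔ ∀ i, z.1 i ∈ S.B x i := by
  constructor
  · rintro rfl
    exact S.thread_mem_B hx (hπ z)
  · intro hz
    have hQ := S.mem_HCube_of_mem_X (hπX z)
    refine eq_of_rho_eq_zero hQ hx (le_antisymm ?_ (rho_nonneg _ _))
    refine ge_of_tendsto' (x := atTop)
      (by simpa using (hπ z).add (S.tendsto_rho_of_mem_B hx hz)) fun i => ?_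
    rw [rho_comm (z.1 i) (π z)]
    exact rho_triangle hQ (S.mem_HCube_of_mem_P (z.2.1 i)) hx

/-- The map `A → B_{x,i}` induced by `g_i`, for a subset `A` of `P_{i+1}` that `g_i` maps into
`B_{x,i}`. -/
def restrictToB {x : ESp} {i : ℕ} {A : Set ESp} (hA : A ⊆ S.P (i + 1))
    (h : MapsTo (S.g i) A (S.B x i)) : C(A, S.B x i) :=
  ⟨h.restrict, ((S.g_cont i).mono hA).mapsToRestrict h⟩

/-- The fibre of the limit map over `x` has trivial shape if each `B_{x,i}` lies in a
contractible subset of `B^#_{x,i}`. -/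
theorem IsLimitMap.hasTrivialShape_fiber {S : InvSeqSetup} {π : S.Thread → ESp}
    (hπ : S.IsLimitMap π) (hπX : ∀ z, π z ∈ S.X) {x : ESp} (hx : x ∈ S.X) (C : ℕ → Set ESp)
    (hC : ∀ i, ContractibleSpace (C i)) (hBC : ∀ i, S.B x i ⊆ C i)
    (hCB : ∀ i, C i ⊆ S.Bs x i) :
    HasTrivialShape {z : S.Thread | π z = x} := by
  have hxQ := S.mem_HCube_of_mem_X hx
  have hmaps : ∀ i, MapsTo (S.g i) (C (i + 1)) (S.B x i) := fun i y hy =>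
    S.g_mem_B_of_mem_Bs hxQ (hCB _ hy)
  have : ∀ i, CompactSpace (S.B x i) := fun i =>
    isCompact_iff_compactSpace.mp (S.isCompact_B hxQ i)
  have : ∀ i, Nonempty (S.B x i) := fun i => ⟨⟨_, S.proj_mem_B hx i⟩⟩
  let g : ∀ i, C(S.B x (i + 1), S.B x i) := fun i =>
    (S.restrictToB (fun _ hy => (hCB _ hy).2) (hmaps i)).comp (inclusionMap (hBC (i + 1)))
  have hg : ∀ i, (g i).Nullhomotopic := fun i =>
    ((id_nullhomotopic (C (i + 1))).comp_left (inclusionMap (hBC (i + 1)))).comp_right _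
  have hmem := hπ.apply_eq_iff hπX hxQ
  refine (InverseSequence.hasTrivialShape_limit g hg).of_leftInverse
    ⟨fun z => ⟨fun i => ⟨z.1.1 i, (hmem z.1).mp z.2 i⟩, fun i => Subtype.ext (z.1.2.2 i)⟩, ?_⟩
    ⟨fun a => ⟨⟨fun i => a.1 i, fun i => (a.1 i).2.2, fun i => congrArg Subtype.val (a.2 i)⟩,
      (hmem _).mpr fun i => (a.1 i).2⟩, ?_⟩ fun z => rfl
  · exact Continuous.subtype_mk (continuous_pi fun i => Continuous.subtype_mk
      ((continuous_apply i).comp (continuous_subtype_val.comp continuous_subtype_val)) _) _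
  · exact Continuous.subtype_mk (Continuous.subtype_mk (continuous_pi fun i =>
      continuous_subtype_val.comp ((continuous_apply i).comp continuous_subtype_val)) _) _

end InvSeqSetup



/-- Corollary 2.2 (II): in the polyhedral inverse-sequence setup, if
for each `x ∈ X` and `i ∈ ℕ` there is a contractible polyhedron `P_{x,i}`, the closed
star of a vertex of `τ̃_i`, with `B_{x,i} ⊆ P_{x,i} ⊆ B^#_{x,i}`, then the limit map
`π : Z → X` is cell-like (each fiber has the shape of a point). -/
theorem statement7 (S : PolySetup) (π : S.toInvSeqSetup.Thread → ESp)
    (hπ : S.toInvSeqSetup.IsLimitMap π)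
    (hπX : ∀ z : S.toInvSeqSetup.Thread, π z ∈ S.toInvSeqSetup.X) (hπc : Continuous π)
    (star : ESp → ℕ → Set ESp) (hstar : S.IsVertexStarSystem star) :
    ∀ x ∈ S.toInvSeqSetup.X,
      HasTrivialShape ↥{z : S.toInvSeqSetup.Thread | π z = x} := by
  intro x hx
  exact hπ.hasTrivialShape_fiber hπX hx (star x) (fun i => (hstar x hx i).2.1)
    (fun i => (hstar x hx i).2.2.1) fun i => (hstar x hx i).2.2.2
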